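/- arXiv:2312.09173 — 3 statements merged into one kernel-verified Lean document; each statement's English description precedes it below -/
import Mathlib

section
/- Let f : ℝⁿ → ℝⁿ be a continuously differentiable vector field with f(0) = 0, and suppose there is a global forward flow s : ℝ → ℝⁿ → ℝⁿ such that for every x ∈ ℝⁿ, t ↦ s t x is differentiable on [0, ∞) with derivative f(s t x) and s 0 x = x. Suppose there exists a nonnegative function ρ : ℝⁿ \ {0} → ℝ, continuously differentiable on ℝⁿ \ {0}, such that x ↦ ρ(x) f(x) / ‖x‖ is integrable on {x : ‖x‖ ≥ 1}, and the divergence ∇·(ρ f)(x) > 0 for Lebesgue-almost every x ∈ ℝⁿ. Then for Lebesgue-almost every initial condition x ∈ ℝⁿ, the solution s t x converges to 0 as t → ∞. -/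
open MeasureTheory Filter Topology

/-- Divergence of a vector field `g : ℝⁿ → ℝⁿ` at `x`: `∑ᵢ ∂gᵢ/∂xᵢ(x)`. -/
noncomputable def divergence {n : ℕ}
    (g : EuclideanSpace ℝ (Fin n) → EuclideanSpace ℝ (Fin n))
    (x : EuclideanSpace ℝ (Fin n)) : ℝ :=
  ∑ i : Fin n, fderiv ℝ g x (EuclideanSpace.single i 1) i

open scoped NNReal ENNReal

section Trajectories

open Set Metric

/-- The integral of `θ` along the trajectory of `x` up to time `T`, truncated at `1`. -/
noncomputable def truncatedOccupation {E : Type*} (s : ℝ → E → E) (θ : E → ℝ) (T : ℝ) (x : E) : ℝ :=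
  min 1 (∫ t in (0 : ℝ)..T, θ (s t x))

lemma truncatedOccupation_nonneg {E : Type*} {s : ℝ → E → E} {θ : E → ℝ} (hθ0 : ∀ x, 0 ≤ θ x)
    {T : ℝ} (hT : 0 ≤ T) (x : E) : 0 ≤ truncatedOccupation s θ T x :=
  le_min zero_le_one (intervalIntegral.integral_nonneg hT fun _ _ => hθ0 _)

lemma truncatedOccupation_le_one {E : Type*} (s : ℝ → E → E) (θ : E → ℝ) (T : ℝ) (x : E) :
    truncatedOccupation s θ T x ≤ 1 :=
  min_le_left _ _

variable {E : Type*} [NormedAddCommGroup E] [NormedSpace ℝ E] {f : E → E} {s : ℝ → E → E}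

lemma continuousOn_comp_flow
    (hs : ∀ x, ∀ t : ℝ, 0 ≤ t → HasDerivAt (fun τ => s τ x) (f (s t x)) t)
    {θ : E → ℝ} (hθ : Continuous θ) (x : E) : ContinuousOn (fun t => θ (s t x)) (Ici 0) :=
  fun t ht => (hθ.continuousAt.comp (hs x t ht).continuousAt).continuousWithinAt

lemma intervalIntegrable_comp_flow
    (hs : ∀ x, ∀ t : ℝ, 0 ≤ t → HasDerivAt (fun τ => s τ x) (f (s t x)) t)
    {θ : E → ℝ} (hθ : Continuous θ) (x : E) {a b : ℝ} (ha : 0 ≤ a) (hb : 0 ≤ b) :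
    IntervalIntegrable (fun t => θ (s t x)) volume a b :=
  ((continuousOn_comp_flow hs hθ x).mono fun _ ht => (le_min ha hb).trans ht.1).intervalIntegrable

variable [ProperSpace E]

/-- Trajectories of a locally Lipschitz vector field starting close to a given trajectory depend on
their initial value in a Lipschitz way, uniformly on compact time intervals. -/
lemma exists_dist_le_mul_dist_of_trajectories (hf : LocallyLipschitz f) {γ : ℝ → E}
    {T : ℝ} (hγ : ∀ t ∈ Icc 0 T, HasDerivAt γ (f (γ t)) t) :
    ∃ δ > 0, ∃ L : ℝ≥0, ∀ α β : ℝ → E,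
      (∀ t ∈ Icc 0 T, HasDerivAt α (f (α t)) t) → (∀ t ∈ Icc 0 T, HasDerivAt β (f (β t)) t) →
      dist (α 0) (γ 0) < δ → dist (β 0) (γ 0) < δ →
      ∀ t ∈ Icc 0 T, dist (α t) (β t) ≤ L * dist (α 0) (β 0) := by
  have cont : ∀ {α : ℝ → E}, (∀ t ∈ Icc 0 T, HasDerivAt α (f (α t)) t) →
      ContinuousOn α (Icc 0 T) :=
    fun h t ht => (h t ht).continuousAt.continuousWithinAt
  obtain ⟨M, hM⟩ := (isCompact_Icc.image_of_continuousOn (cont hγ)).isBounded.subset_closedBall 0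
  obtain ⟨K, hK⟩ := LocallyLipschitzOn.exists_lipschitzOnWith_of_compact
    (isCompact_closedBall (0 : E) (M + 1)) hf.locallyLipschitzOn
  have gronwall : ∀ {α β : ℝ → E} {b : ℝ}, b ≤ T →
      (∀ t ∈ Icc 0 T, HasDerivAt α (f (α t)) t) → (∀ t ∈ Icc 0 T, HasDerivAt β (f (β t)) t) →
      (∀ t ∈ Ico 0 b, α t ∈ closedBall 0 (M + 1)) → (∀ t ∈ Ico 0 b, β t ∈ closedBall 0 (M + 1)) →
      ∀ t ∈ Icc 0 b, dist (α t) (β t) ≤ Real.exp (K * T) * dist (α 0) (β 0) := by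
    intro α β b hb hα hβ hαM hβM t ht
    have hsub : Icc 0 b ⊆ Icc 0 T := Icc_subset_Icc_right hb
    have h := dist_le_of_trajectories_ODE_of_mem (v := fun _ => f)
      (s := fun _ => closedBall (0 : E) (M + 1)) (fun _ _ => hK) ((cont hα).mono hsub)
      (fun t ht => (hα t (hsub (Ico_subset_Icc_self ht))).hasDerivWithinAt) hαM
      ((cont hβ).mono hsub)
      (fun t ht => (hβ t (hsub (Ico_subset_Icc_self ht))).hasDerivWithinAt) hβM le_rfl t ht
    refine h.trans ?_
    rw [mul_comm]
    gcongr
    linarith [ht.2]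
  have hγM : ∀ t ∈ Icc 0 T, ‖γ t‖ ≤ M := fun t ht => by
    simpa using hM (mem_image_of_mem γ ht)
  have stay : ∀ {α : ℝ → E}, (∀ t ∈ Icc 0 T, HasDerivAt α (f (α t)) t) →
      dist (α 0) (γ 0) < (Real.exp (K * T))⁻¹ → ∀ t ∈ Icc 0 T, dist (α t) (γ t) < 1 := by
    intro α hα hδ
    by_contra! hcon
    obtain ⟨t₁, ht₁, h₁⟩ := hcon
    have hcont : ContinuousOn (fun t => dist (α t) (γ t)) (Icc 0 T) :=
      continuous_dist.comp_continuousOn ((cont hα).prodMk (cont hγ))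
    have hclosed : IsClosed (Icc 0 T ∩ {t | 1 ≤ dist (α t) (γ t)}) :=
      hcont.preimage_isClosed_of_isClosed isClosed_Icc isClosed_Ici
    obtain ⟨t₀, ⟨ht₀, h₀⟩, hmin⟩ :=
      (isCompact_Icc.of_isClosed_subset hclosed inter_subset_left).exists_isLeast ⟨t₁, ht₁, h₁⟩
    have hlt : ∀ t ∈ Ico 0 t₀, dist (α t) (γ t) < 1 := by
      intro t ht
      by_contra! h
      exact absurd (hmin ⟨⟨ht.1, ht.2.le.trans ht₀.2⟩, h⟩) (not_le.2 ht.2)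
    have hin : ∀ t ∈ Ico 0 t₀, ‖γ t‖ ≤ M := fun t ht => hγM t ⟨ht.1, ht.2.le.trans ht₀.2⟩
    have h := gronwall ht₀.2 hα hγ
      (fun t ht => by
        rw [mem_closedBall_zero_iff]
        have h := norm_le_norm_add_norm_sub' (α t) (γ t)
        rw [← dist_eq_norm] at h
        linarith [hlt t ht, hin t ht])
      (fun t ht => by
        rw [mem_closedBall_zero_iff]
        linarith [hin t ht]) t₀ ⟨ht₀.1, le_rfl⟩
    have h' : Real.exp (K * T) * dist (α 0) (γ 0) < 1 := by
      rw [← mul_inv_cancel₀ (Real.exp_pos (K * T)).ne']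
      gcongr
    exact absurd (h₀.trans h) (not_le.2 h')
  have stay' : ∀ {α : ℝ → E}, (∀ t ∈ Icc 0 T, HasDerivAt α (f (α t)) t) →
      dist (α 0) (γ 0) < (Real.exp (K * T))⁻¹ → ∀ t ∈ Ico 0 T, α t ∈ closedBall 0 (M + 1) := by
    intro α hα hδ t ht
    rw [mem_closedBall_zero_iff]
    have h := norm_le_norm_add_norm_sub' (α t) (γ t)
    rw [← dist_eq_norm] at h
    linarith [stay hα hδ t (Ico_subset_Icc_self ht), hγM t (Ico_subset_Icc_self ht)]
  exact ⟨_, inv_pos.2 (Real.exp_pos (K * T)), ⟨Real.exp (K * T), (Real.exp_pos _).le⟩,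
    fun α β hα hβ hα0 hβ0 => gronwall le_rfl hα hβ (stay' hα hα0) (stay' hβ hβ0)⟩

lemma eqOn_of_trajectories (hf : LocallyLipschitz f) {α β : ℝ → E} {T : ℝ}
    (hα : ∀ t ∈ Icc 0 T, HasDerivAt α (f (α t)) t) (hβ : ∀ t ∈ Icc 0 T, HasDerivAt β (f (β t)) t)
    (h0 : α 0 = β 0) : EqOn α β (Icc 0 T) := by
  obtain ⟨δ, hδ, L, hL⟩ := exists_dist_le_mul_dist_of_trajectories hf hα
  intro t ht
  have h := hL α β hα hβ (by simpa using hδ) (by simpa [h0] using hδ) t ht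
  rw [h0, dist_self, mul_zero] at h
  exact dist_le_zero.1 h

/-- The flow of a locally Lipschitz vector field has the semigroup property. -/
lemma flow_add (hf : LocallyLipschitz f) (hs0 : ∀ x, s 0 x = x)
    (hs : ∀ x, ∀ t : ℝ, 0 ≤ t → HasDerivAt (fun τ => s τ x) (f (s t x)) t)
    (x : E) {h t : ℝ} (hh : 0 ≤ h) (ht : 0 ≤ t) : s t (s h x) = s (t + h) x :=
  eqOn_of_trajectories (α := fun t => s t (s h x)) (β := fun t => s (t + h) x) hf
    (fun τ hτ => hs _ τ hτ.1)
    (fun τ hτ => (hs x (τ + h) (add_nonneg hτ.1 hh)).comp_add_const τ h)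
    (by simp [hs0]) ⟨ht, le_rfl⟩

/-- The flow is locally Lipschitz in space, uniformly on compact time intervals. -/
lemma exists_lipschitz_flow (hf : LocallyLipschitz f) (hs0 : ∀ x, s 0 x = x)
    (hs : ∀ x, ∀ t : ℝ, 0 ≤ t → HasDerivAt (fun τ => s τ x) (f (s t x)) t) (x₀ : E) (T : ℝ) :
    ∃ δ > 0, ∃ L : ℝ≥0, ∀ x ∈ ball x₀ δ, ∀ y ∈ ball x₀ δ, ∀ t ∈ Icc 0 T,
      dist (s t x) (s t y) ≤ L * dist x y := by
  obtain ⟨δ, hδ, L, hL⟩ := exists_dist_le_mul_dist_of_trajectories (T := T) hf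
    (fun t ht => hs x₀ t ht.1)
  refine ⟨δ, hδ, L, fun x hx y hy t ht => ?_⟩
  simpa only [hs0] using hL (fun t => s t x) (fun t => s t y) (fun t ht => hs x t ht.1)
    (fun t ht => hs y t ht.1) (by simpa [hs0] using hx) (by simpa [hs0] using hy) t ht

lemma flow_zero (hf : LocallyLipschitz f) (hf0 : f 0 = 0) (hs0 : ∀ x, s 0 x = x)
    (hs : ∀ x, ∀ t : ℝ, 0 ≤ t → HasDerivAt (fun τ => s τ x) (f (s t x)) t) {t : ℝ} (ht : 0 ≤ t) :
    s t 0 = 0 :=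
  eqOn_of_trajectories (α := fun t => s t 0) (β := fun _ => 0) hf (fun τ hτ => hs _ τ hτ.1)
    (fun τ _ => by simpa only [hf0] using hasDerivAt_const τ (0 : E)) (hs0 0) ⟨ht, le_rfl⟩

lemma locallyLipschitz_truncatedOccupation (hf : LocallyLipschitz f) (hs0 : ∀ x, s 0 x = x)
    (hs : ∀ x, ∀ t : ℝ, 0 ≤ t → HasDerivAt (fun τ => s τ x) (f (s t x)) t)
    {θ : E → ℝ} {C : ℝ≥0} (hθ : LipschitzWith C θ) {T : ℝ} (hT : 0 ≤ T) :
    LocallyLipschitz (truncatedOccupation s θ T) := by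
  refine LocallyLipschitz.const_min (fun x₀ => ?_) 1
  obtain ⟨δ, hδ, L, hL⟩ := exists_lipschitz_flow hf hs0 hs x₀ T
  refine ⟨C * L * T.toNNReal, ball x₀ δ, ball_mem_nhds x₀ hδ,
    LipschitzOnWith.of_dist_le_mul fun x hx y hy => ?_⟩
  rw [dist_eq_norm, ← intervalIntegral.integral_sub
    (intervalIntegrable_comp_flow hs hθ.continuous x le_rfl hT)
    (intervalIntegrable_comp_flow hs hθ.continuous y le_rfl hT)]
  have h := intervalIntegral.norm_integral_le_of_norm_le_const (a := 0) (b := T)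
    (f := fun t => θ (s t x) - θ (s t y)) (C := C * (L * dist x y)) fun t ht => by
      rw [uIoc_of_le hT] at ht
      rw [← dist_eq_norm]
      refine (hθ.dist_le_mul _ _).trans ?_
      gcongr
      exact hL x hx y hy t (Ioc_subset_Icc_self ht)
  refine h.trans_eq ?_
  rw [sub_zero, abs_of_nonneg hT]
  push_cast
  rw [Real.coe_toNNReal T hT]
  ring

lemma truncatedOccupation_eventuallyEq_zero (hf : LocallyLipschitz f) (hf0 : f 0 = 0)
    (hs0 : ∀ x, s 0 x = x)
    (hs : ∀ x, ∀ t : ℝ, 0 ≤ t → HasDerivAt (fun τ => s τ x) (f (s t x)) t)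
    {θ : E → ℝ} (hθ : θ =ᶠ[𝓝 0] 0) {T : ℝ} (hT : 0 ≤ T) :
    truncatedOccupation s θ T =ᶠ[𝓝 0] 0 := by
  obtain ⟨δ, hδ, L, hL⟩ := exists_lipschitz_flow hf hs0 hs 0 T
  obtain ⟨r, hr, hθr⟩ := Metric.eventually_nhds_iff_ball.1 hθ
  have hsmall : ∀ᶠ x : E in 𝓝 0, L * dist x 0 < r := by
    have : Tendsto (fun x : E => L * dist x 0) (𝓝 0) (𝓝 (L * dist (0 : E) 0)) :=
      Continuous.tendsto (by fun_prop) 0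
    rw [dist_self, mul_zero] at this
    exact this.eventually_lt_const hr
  filter_upwards [hsmall, ball_mem_nhds (0 : E) hδ] with x hx hxδ
  have h : ∫ t in (0 : ℝ)..T, θ (s t x) = ∫ t in (0 : ℝ)..T, (0 : ℝ) := by
    refine intervalIntegral.integral_congr fun t ht => ?_
    rw [uIcc_of_le hT] at ht
    refine hθr _ (mem_ball.2 (lt_of_le_of_lt ?_ hx))
    simpa only [flow_zero hf hf0 hs0 hs ht.1] using hL x hxδ 0 (mem_ball_self hδ) t ht
  simp [truncatedOccupation, h]

/-- Along the flow, the truncated occupation time decreases at most at rate `θ`. -/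
lemma truncatedOccupation_sub_le (hf : LocallyLipschitz f) (hs0 : ∀ x, s 0 x = x)
    (hs : ∀ x, ∀ t : ℝ, 0 ≤ t → HasDerivAt (fun τ => s τ x) (f (s t x)) t)
    {θ : E → ℝ} (hθ : Continuous θ) (hθ0 : ∀ x, 0 ≤ θ x) {T : ℝ} (hT : 0 ≤ T) (x : E) {h : ℝ}
    (hh : 0 ≤ h) :
    truncatedOccupation s θ T x - ∫ t in (0 : ℝ)..h, θ (s t x) ≤
      truncatedOccupation s θ T (s h x) := by
  have hint := fun {a b : ℝ} (ha : 0 ≤ a) (hb : 0 ≤ b) =>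
    intervalIntegrable_comp_flow hs hθ x ha hb
  have hshift : ∫ t in (0 : ℝ)..T, θ (s t (s h x)) = ∫ t in h..(T + h), θ (s t x) := by
    have hcomp := intervalIntegral.integral_comp_add_right (a := 0) (b := T) (fun t => θ (s t x)) h
    rw [zero_add] at hcomp
    rw [← hcomp]
    refine intervalIntegral.integral_congr fun t ht => ?_
    rw [uIcc_of_le hT] at ht
    simp only [flow_add hf hs0 hs x hh ht.1]
  have h₁ : (∫ t in (0 : ℝ)..h, θ (s t x)) + ∫ t in h..(T + h), θ (s t x) =
      (∫ t in (0 : ℝ)..T, θ (s t x)) + ∫ t in T..(T + h), θ (s t x) := by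
    rw [intervalIntegral.integral_add_adjacent_intervals,
      intervalIntegral.integral_add_adjacent_intervals]
    all_goals exact hint (by positivity) (by positivity)
  have h₂ : 0 ≤ ∫ t in T..(T + h), θ (s t x) :=
    intervalIntegral.integral_nonneg (by linarith) fun _ _ => hθ0 _
  have h₃ : 0 ≤ ∫ t in (0 : ℝ)..h, θ (s t x) :=
    intervalIntegral.integral_nonneg hh fun _ _ => hθ0 _
  unfold truncatedOccupation
  rw [hshift]
  refine le_min ?_ ?_
  · linarith [min_le_left 1 (∫ t in (0 : ℝ)..T, θ (s t x))]
  · linarith [min_le_right 1 (∫ t in (0 : ℝ)..T, θ (s t x))]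

lemma neg_le_fderiv_truncatedOccupation (hf : LocallyLipschitz f) (hs0 : ∀ x, s 0 x = x)
    (hs : ∀ x, ∀ t : ℝ, 0 ≤ t → HasDerivAt (fun τ => s τ x) (f (s t x)) t)
    {θ : E → ℝ} (hθ : Continuous θ) (hθ0 : ∀ x, 0 ≤ θ x) {T : ℝ} (hT : 0 ≤ T) {x : E}
    (hx : DifferentiableAt ℝ (truncatedOccupation s θ T) x) :
    -θ x ≤ fderiv ℝ (truncatedOccupation s θ T) x (f x) := by
  have h₁ : HasDerivWithinAt (fun h => truncatedOccupation s θ T (s h x))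
      (fderiv ℝ (truncatedOccupation s θ T) x (f x)) (Ici 0) 0 := by
    have h := hs x 0 le_rfl
    rw [hs0] at h
    have hx' := hx.hasFDerivAt
    nth_rw 2 [← hs0 x] at hx'
    exact (hx'.comp_hasDerivAt 0 h).hasDerivWithinAt
  have h₂ : HasDerivWithinAt (fun h => ∫ t in (0 : ℝ)..h, θ (s t x)) (θ x) (Ici 0) 0 := by
    have hc := continuousOn_comp_flow hs hθ x
    have h := intervalIntegral.integral_hasDerivWithinAt_right (a := 0) (b := 0)
      (s := Ici 0) (t := Ioi 0) (f := fun t => θ (s t x)) (by simp)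
      ⟨Ici 0, mem_of_superset self_mem_nhdsWithin Ioi_subset_Ici_self,
        hc.aestronglyMeasurable measurableSet_Ici⟩ ((hc 0 self_mem_Ici).mono Ioi_subset_Ici_self)
    simpa only [hs0] using h
  have h₃ := h₁.add h₂
  have h₄ : ∀ h ∈ Ici (0 : ℝ), truncatedOccupation s θ T (s 0 x) + ∫ t in (0 : ℝ)..0, θ (s t x) ≤
      truncatedOccupation s θ T (s h x) + ∫ t in (0 : ℝ)..h, θ (s t x) := fun h hh => by
    have := truncatedOccupation_sub_le hf hs0 hs hθ hθ0 hT x hh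
    rw [intervalIntegral.integral_same, hs0]
    linarith
  have h₅ : 0 ≤ fderiv ℝ (truncatedOccupation s θ T) x (f x) + θ x := by
    have hcone : (1 : ℝ) ∈ posTangentConeAt (Ici (0 : ℝ)) 0 :=
      mem_posTangentConeAt_of_segment_subset <|
        (convex_Ici 0).segment_subset self_mem_Ici (by simp)
    have hmin : IsLocalMinOn (fun h => truncatedOccupation s θ T (s h x) +
        ∫ t in (0 : ℝ)..h, θ (s t x)) (Ici 0) 0 :=
      eventually_nhdsWithin_of_forall h₄
    simpa using hmin.hasFDerivWithinAt_nonneg h₃.hasFDerivWithinAt hcone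
  linarith

end Trajectories

section Divergence

variable {n : ℕ}

local notation "𝔼" => EuclideanSpace ℝ (Fin n)

lemma measurable_divergence (g : 𝔼 → 𝔼) : Measurable (divergence g) := by
  have h (i : Fin n) : Measurable fun x => fderiv ℝ g x (EuclideanSpace.single i 1) i :=
    (EuclideanSpace.proj (𝕜 := ℝ) i).continuous.measurable.comp
      (measurable_fderiv_apply_const ℝ g _)
  exact Finset.measurable_sum _ fun i _ => h i

lemma Filter.EventuallyEq.divergence_eq {g₁ g₂ : 𝔼 → 𝔼} {x : 𝔼} (h : g₁ =ᶠ[𝓝 x] g₂) :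
    divergence g₁ x = divergence g₂ x := by
  simp only [divergence, h.fderiv_eq]

lemma divergence_smul {φ : 𝔼 → ℝ} {g : 𝔼 → 𝔼} {x : 𝔼} (hφ : DifferentiableAt ℝ φ x)
    (hg : DifferentiableAt ℝ g x) :
    divergence (fun y => φ y • g y) x = φ x * divergence g x + fderiv ℝ φ x (g x) := by
  have hsum : fderiv ℝ φ x (g x) = ∑ i, g x i * fderiv ℝ φ x (EuclideanSpace.single i 1) := by
    conv_lhs => rw [← (EuclideanSpace.basisFun (Fin n) ℝ).sum_repr (g x)]
    simp
  rw [hsum, divergence, divergence, fderiv_fun_smul hφ hg, Finset.mul_sum, ← Finset.sum_add_distrib]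
  refine Finset.sum_congr rfl fun i _ => ?_
  simp [mul_comm]

lemma continuousOn_divergence {g : 𝔼 → 𝔼} {U : Set 𝔼} (hU : IsOpen U) (hg : ContDiffOn ℝ 1 g U) :
    ContinuousOn (divergence g) U := by
  have h := hg.continuousOn_fderiv_of_isOpen hU le_rfl
  refine continuousOn_finsetSum _ fun i _ => ?_
  exact (EuclideanSpace.proj (𝕜 := ℝ) i).continuous.comp_continuousOn
    (h.clm_apply continuousOn_const)

/-- Integration by parts inequality: if the derivative of a locally Lipschitz function `V` along a
compactly supported `C¹` vector field `F` is bounded below by `-G`, then `∫ V ∇·F ≤ ∫ G`. -/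
lemma integral_mul_divergence_le {V : 𝔼 → ℝ} (hV : LocallyLipschitz V) {F : 𝔼 → 𝔼}
    (hF : ContDiff ℝ 1 F) (hFc : HasCompactSupport F) {G : 𝔼 → ℝ} (hG : Integrable G)
    (hG0 : ∀ x, 0 ≤ G x) (hVG : ∀ x, DifferentiableAt ℝ V x → -G x ≤ fderiv ℝ V x (F x)) :
    ∫ x, V x * divergence F x ≤ ∫ x, G x := by
  obtain ⟨M, hM⟩ := hFc.isBounded.subset_ball 0
  obtain ⟨K, hK⟩ := LocallyLipschitzOn.exists_lipschitzOnWith_of_compact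
    (isCompact_closedBall (0 : 𝔼) M) hV.locallyLipschitzOn
  obtain ⟨W, hW, hVW⟩ := hK.extend_real
  have hcoord (i : Fin n) : ContDiff ℝ 1 fun x => F x i :=
    (EuclideanSpace.proj (𝕜 := ℝ) i).contDiff.comp hF
  have hcoordc (i : Fin n) : HasCompactSupport fun x => F x i :=
    hFc.comp_left (g := fun v : 𝔼 => v i) rfl
  have hderiv (i : Fin n) (x : 𝔼) : lineDeriv ℝ (fun x => F x i) x (-EuclideanSpace.single i 1) =
      -fderiv ℝ F x (EuclideanSpace.single i 1) i := by
    have h : HasFDerivAt (fun x => F x i)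
        ((EuclideanSpace.proj (𝕜 := ℝ) i).comp (fderiv ℝ F x)) x :=
      (EuclideanSpace.proj (𝕜 := ℝ) i).hasFDerivAt.comp x
        ((hF.differentiable one_ne_zero).differentiableAt.hasFDerivAt)
    rw [(h.hasLineDerivAt _).lineDeriv]
    simp
  have hparts (i : Fin n) :
      ∫ x, W x * fderiv ℝ F x (EuclideanSpace.single i 1) i =
        ∫ x, -(lineDeriv ℝ W x (EuclideanSpace.single i 1) * F x i) := by
    obtain ⟨D, hD⟩ := (hcoord i).lipschitzWith_of_hasCompactSupport (hcoordc i) one_ne_zero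
    rw [integral_neg, hW.integral_lineDeriv_mul_eq hD (hcoordc i), ← integral_neg]
    refine integral_congr_ae (.of_forall fun x => ?_)
    simp only [hderiv]
    ring
  have hint (i : Fin n) :
      Integrable fun x => -(lineDeriv ℝ W x (EuclideanSpace.single i 1) * F x i) :=
    (((hcoord i).continuous.integrable_of_hasCompactSupport (hcoordc i)).bdd_mul
      (aestronglyMeasurable_lineDeriv hW.continuous _)
      (.of_forall fun _ => norm_lineDeriv_le_of_lipschitz ℝ hW)).neg
  have hint' (i : Fin n) :
      Integrable fun x => W x * fderiv ℝ F x (EuclideanSpace.single i 1) i := by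
    refine Continuous.integrable_of_hasCompactSupport (hW.continuous.mul ?_) ?_
    · exact (EuclideanSpace.proj (𝕜 := ℝ) i).continuous.comp
        ((hF.continuous_fderiv one_ne_zero).clm_apply continuous_const)
    · exact ((hFc.fderiv_apply ℝ (EuclideanSpace.single i 1)).comp_left
        (g := fun v : 𝔼 => v i) rfl).mul_left
  have hVWdiv (x : 𝔼) : V x * divergence F x =
      ∑ i, W x * fderiv ℝ F x (EuclideanSpace.single i 1) i := by
    rw [divergence, Finset.mul_sum]
    by_cases hx : x ∈ tsupport F
    · rw [hVW (Metric.ball_subset_closedBall (hM hx))]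
    · have h0 : fderiv ℝ F x = 0 :=
        Function.notMem_support.1 fun h => hx (support_fderiv_subset ℝ h)
      simp [h0]
  calc ∫ x, V x * divergence F x
      = ∫ x, ∑ i, W x * fderiv ℝ F x (EuclideanSpace.single i 1) i := by simp only [hVWdiv]
    _ = ∫ x, ∑ i, -(lineDeriv ℝ W x (EuclideanSpace.single i 1) * F x i) := by
      rw [integral_finsetSum _ fun i _ => hint' i,
        integral_finsetSum _ fun i _ => hint i]
      exact Finset.sum_congr rfl fun i _ => hparts i
    _ ≤ ∫ x, G x := by
      refine integral_mono_ae (integrable_finsetSum _ fun i _ => hint i) hG ?_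
      filter_upwards [hW.ae_differentiableAt] with x hx
      have hsum : ∑ i, -(lineDeriv ℝ W x (EuclideanSpace.single i 1) * F x i) =
          -fderiv ℝ W x (F x) := by
        conv_rhs => rw [← (EuclideanSpace.basisFun (Fin n) ℝ).sum_repr (F x)]
        simp [hx.lineDeriv_eq_fderiv, mul_comm]
      rw [hsum]
      by_cases hxF : x ∈ tsupport F
      · have heq : V =ᶠ[𝓝 x] W :=
          hVW.eventuallyEq_of_mem (mem_of_superset (Metric.isOpen_ball.mem_nhds (hM hxF))
            Metric.ball_subset_closedBall)
        have h := hVG x (heq.differentiableAt_iff.2 hx)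
        rw [heq.fderiv_eq] at h
        linarith
      · simpa [image_eq_zero_of_notMem_tsupport hxF] using hG0 x

lemma continuous_of_continuousOn_compl_of_eventuallyEq {X Y : Type*} [TopologicalSpace X]
    [T1Space X] [TopologicalSpace Y] {g : X → Y} {a : X} {c : Y} (hg : ContinuousOn g {a}ᶜ)
    (ha : g =ᶠ[𝓝 a] fun _ => c) : Continuous g := by
  refine continuous_iff_continuousAt.2 fun x => ?_
  by_cases hx : x = a
  · rw [hx]
    exact continuousAt_const.congr ha.symm
  · exact hg.continuousAt (isOpen_compl_singleton.mem_nhds hx)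

variable {f : EuclideanSpace ℝ (Fin n) → EuclideanSpace ℝ (Fin n)}
  {s : ℝ → EuclideanSpace ℝ (Fin n) → EuclideanSpace ℝ (Fin n)} {ρ : EuclideanSpace ℝ (Fin n) → ℝ}

lemma integral_truncatedOccupation_mul_divergence_le (hf : ContDiff ℝ 1 f) (hf0 : f 0 = 0)
    (hs0 : ∀ x, s 0 x = x)
    (hs : ∀ x, ∀ t : ℝ, 0 ≤ t → HasDerivAt (fun τ => s τ x) (f (s t x)) t)
    (hρ0 : ∀ x, x ≠ 0 → 0 ≤ ρ x) (hρ : ContDiffOn ℝ 1 ρ {(0 : 𝔼)}ᶜ)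
    {θ : 𝔼 → ℝ} {C : ℝ≥0} (hθ : LipschitzWith C θ) (hθ0 : ∀ x, 0 ≤ θ x) (hθz : θ =ᶠ[𝓝 0] 0)
    {χ : 𝔼 → ℝ} (hχ : ContDiff ℝ 1 χ) (hχc : HasCompactSupport χ) (hχ0 : ∀ x, 0 ≤ χ x)
    {T : ℝ} (hT : 0 ≤ T) :
    ∫ x, truncatedOccupation s θ T x *
        (χ x * divergence (fun y => ρ y • f y) x + ρ x * fderiv ℝ χ x (f x)) ≤
      ∫ x, χ x * ρ x * θ x := by
  have hfl : LocallyLipschitz f := hf.locallyLipschitz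
  set V := truncatedOccupation s θ T
  have hVL : LocallyLipschitz V := locallyLipschitz_truncatedOccupation hfl hs0 hs hθ hT
  have hV0 : V =ᶠ[𝓝 0] 0 := truncatedOccupation_eventuallyEq_zero hfl hf0 hs0 hs hθz hT
  obtain ⟨r, hr, hVr⟩ := Metric.eventually_nhds_iff_ball.1 (hV0.and hθz)
  let β : ContDiffBump (0 : 𝔼) := ⟨r / 4, r / 2, by positivity, by linarith⟩
  have hβout {x : 𝔼} (hx : x ∉ Metric.ball (0 : 𝔼) r) : (β : 𝔼 → ℝ) =ᶠ[𝓝 x] 0 := by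
    rw [← notMem_tsupport_iff_eventuallyEq, β.tsupport_eq]
    exact fun h => hx (Metric.closedBall_subset_ball (half_lt_self hr) h)
  have hβ0 : (β : 𝔼 → ℝ) =ᶠ[𝓝 0] 1 := β.eventuallyEq_one
  let ψ : 𝔼 → ℝ := fun x => (1 - β x) * χ x
  have hψ : ContDiff ℝ 1 ψ := (contDiff_const.sub β.contDiff).mul hχ
  have hψ0 : ψ =ᶠ[𝓝 0] 0 := by
    filter_upwards [hβ0] with x hx
    simp [ψ, hx]
  have hψnonneg (x : 𝔼) : 0 ≤ ψ x := mul_nonneg (sub_nonneg.2 β.le_one) (hχ0 x)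
  have hψc : HasCompactSupport ψ := hχc.mul_left
  have hψρ : ContDiff ℝ 1 fun x => ψ x * ρ x := by
    refine contDiff_iff_contDiffAt.2 fun x => ?_
    by_cases hx : x = 0
    · refine ContDiffAt.congr_of_eventuallyEq (f := fun _ => (0 : ℝ)) contDiffAt_const ?_
      rw [hx]
      filter_upwards [hψ0] with y hy
      simp [hy]
    · exact hψ.contDiffAt.mul (hρ.contDiffAt (isOpen_compl_singleton.mem_nhds hx))
  have hnonneg (x : 𝔼) : 0 ≤ ψ x * ρ x := by
    by_cases hx : x = 0
    · rw [hx, hψ0.eq_of_nhds]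
      simp
    · exact mul_nonneg (hψnonneg x) (hρ0 x hx)
  have key := integral_mul_divergence_le hVL (F := fun x => (ψ x * ρ x) • f x)
    (G := fun x => ψ x * ρ x * θ x) (hψρ.smul hf) hψc.mul_right.smul_right
    ((hψρ.continuous.mul hθ.continuous).integrable_of_hasCompactSupport hψc.mul_right.mul_right)
    (fun x => mul_nonneg (hnonneg x) (hθ0 x)) fun x hx => by
      rw [map_smul, smul_eq_mul, ← mul_neg]
      exact mul_le_mul_of_nonneg_left
        (neg_le_fderiv_truncatedOccupation hfl hs0 hs hθ.continuous hθ0 hT hx) (hnonneg x)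
  convert key using 1
  · refine integral_congr_ae (.of_forall fun x => ?_)
    by_cases hx : x ∈ Metric.ball (0 : 𝔼) r
    · simp [(hVr x hx).1]
    · have hx0 : x ≠ 0 := fun h => hx (h ▸ Metric.mem_ball_self hr)
      have heq : (fun y => (ψ y * ρ y) • f y) =ᶠ[𝓝 x] fun y => χ y • (ρ y • f y) := by
        filter_upwards [hβout hx] with y hy
        simp [ψ, hy, mul_smul]
      have hρd : DifferentiableAt ℝ ρ x :=
        (hρ.contDiffAt (isOpen_compl_singleton.mem_nhds hx0)).differentiableAt one_ne_zero
      simp only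
      rw [heq.divergence_eq, divergence_smul (g := fun y => ρ y • f y)
        (hχ.differentiable one_ne_zero x) (hρd.smul (hf.differentiable one_ne_zero x)),
        map_smul, smul_eq_mul]
  · refine integral_congr_ae (.of_forall fun x => ?_)
    by_cases hx : x ∈ Metric.ball (0 : 𝔼) r
    · simp [(hVr x hx).2]
    · simp [ψ, (hβout hx).eq_of_nhds]

lemma continuous_mul_fderiv_apply (hf : Continuous f) (hρ : ContinuousOn ρ {(0 : 𝔼)}ᶜ)
    {χ : 𝔼 → ℝ} (hχ : ContDiff ℝ 1 χ) (hχ1 : χ =ᶠ[𝓝 0] 1) :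
    Continuous fun x => ρ x * fderiv ℝ χ x (f x) := by
  refine continuous_of_continuousOn_compl_of_eventuallyEq (a := 0) (c := 0)
    (hρ.mul ((hχ.continuous_fderiv one_ne_zero).clm_apply hf).continuousOn) ?_
  have hfd0 : fderiv ℝ χ =ᶠ[𝓝 0] 0 := by
    simpa using (hχ1.fderiv (𝕜 := ℝ)).trans (.of_forall fun x => by simp)
  filter_upwards [hfd0] with x hx
  simp [hx]

/-- Along the flow, the divergence of `ρ • f` weighted by the truncated occupation and a cutoff `χ`
is controlled by `∫ χ ρ θ` and the flux of `ρ • f` through the transition region of `χ`. -/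
lemma lintegral_truncatedOccupation_mul_divergence_le (hf : ContDiff ℝ 1 f) (hf0 : f 0 = 0)
    (hs0 : ∀ x, s 0 x = x)
    (hs : ∀ x, ∀ t : ℝ, 0 ≤ t → HasDerivAt (fun τ => s τ x) (f (s t x)) t)
    (hρ0 : ∀ x, x ≠ 0 → 0 ≤ ρ x) (hρ : ContDiffOn ℝ 1 ρ {(0 : 𝔼)}ᶜ)
    (hdiv : ∀ᵐ x : 𝔼, 0 < divergence (fun y => ρ y • f y) x)
    {θ : 𝔼 → ℝ} {C : ℝ≥0} (hθ : LipschitzWith C θ) (hθ0 : ∀ x, 0 ≤ θ x) (hθz : θ =ᶠ[𝓝 0] 0)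
    {χ : 𝔼 → ℝ} (hχ : ContDiff ℝ 1 χ) (hχc : HasCompactSupport χ) (hχ0 : ∀ x, 0 ≤ χ x)
    (hχ1 : χ =ᶠ[𝓝 0] 1) {T : ℝ} (hT : 0 ≤ T) :
    ∫⁻ x, ENNReal.ofReal
        (truncatedOccupation s θ T x * (χ x * divergence (fun y => ρ y • f y) x)) ≤
      ENNReal.ofReal ((∫ x, χ x * ρ x * θ x) + ∫ x, |ρ x * fderiv ℝ χ x (f x)|) := by
  have hfl : LocallyLipschitz f := hf.locallyLipschitz
  have key := integral_truncatedOccupation_mul_divergence_le hf hf0 hs0 hs hρ0 hρ hθ hθ0 hθz hχ hχc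
    hχ0 hT
  set V := truncatedOccupation s θ T
  have hVc : Continuous V := (locallyLipschitz_truncatedOccupation hfl hs0 hs hθ hT).continuous
  have hV0 : V =ᶠ[𝓝 0] 0 := truncatedOccupation_eventuallyEq_zero hfl hf0 hs0 hs hθz hT
  have hVnonneg : ∀ x, 0 ≤ V x := truncatedOccupation_nonneg hθ0 hT
  have hV1 : ∀ x, V x ≤ 1 := truncatedOccupation_le_one s θ T
  have hdc : ContinuousOn (divergence fun y => ρ y • f y) {(0 : 𝔼)}ᶜ :=
    continuousOn_divergence isOpen_compl_singleton (hρ.smul hf.contDiffOn)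
  have hint₁ : Integrable fun x => V x * (χ x * divergence (fun y => ρ y • f y) x) := by
    refine Continuous.integrable_of_hasCompactSupport
      (continuous_of_continuousOn_compl_of_eventuallyEq (a := 0) (c := 0)
        (hVc.continuousOn.mul (hχ.continuous.continuousOn.mul hdc)) ?_) hχc.mul_right.mul_left
    filter_upwards [hV0] with x hx
    simp [hx]
  have hint₂ : Integrable fun x => ρ x * fderiv ℝ χ x (f x) := by
    refine (continuous_mul_fderiv_apply hf.continuous hρ.continuousOn hχ
      hχ1).integrable_of_hasCompactSupport (HasCompactSupport.mul_left ?_)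
    refine (hχc.fderiv ℝ).mono fun x hx => ?_
    contrapose! hx
    simp [Function.notMem_support.1 hx]
  have hint₃ : Integrable fun x => V x * (ρ x * fderiv ℝ χ x (f x)) :=
    hint₂.bdd_mul (c := 1) hVc.aestronglyMeasurable
      (.of_forall fun x => by rw [Real.norm_of_nonneg (hVnonneg x)]; exact hV1 x)
  simp only [mul_add] at key
  rw [integral_add hint₁ hint₃] at key
  have hbound : -∫ x, V x * (ρ x * fderiv ℝ χ x (f x)) ≤ ∫ x, |ρ x * fderiv ℝ χ x (f x)| := by
    rw [← integral_neg]
    refine integral_mono hint₃.neg hint₂.abs fun x => ?_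
    refine (neg_le_abs _).trans ?_
    rw [abs_mul, abs_of_nonneg (hVnonneg x)]
    exact mul_le_of_le_one_left (abs_nonneg _) (hV1 x)
  rw [← ofReal_integral_eq_lintegral_ofReal hint₁]
  · exact ENNReal.ofReal_le_ofReal (by linarith)
  · filter_upwards [hdiv] with x hx
    exact mul_nonneg (hVnonneg x) (mul_nonneg (hχ0 x) hx.le)

/-- The flux of `ρ • f` through the transition region of a dilated cutoff tends to zero. -/
lemma tendsto_integral_abs_mul_fderiv_cutoff (hf : Continuous f)
    (hρ : ContinuousOn ρ {(0 : 𝔼)}ᶜ)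
    (h_int : IntegrableOn (fun x => (ρ x / ‖x‖) • f x) {x : 𝔼 | 1 ≤ ‖x‖})
    {b : 𝔼 → ℝ} (hb : ContDiff ℝ 1 b) (hbc : HasCompactSupport b)
    (hb1 : ∀ x ∈ Metric.ball (0 : 𝔼) 1, b x = 1) :
    Tendsto (fun m : ℕ => ∫ x, |ρ x * fderiv ℝ (fun y => b ((m + 1 : ℝ)⁻¹ • y)) x (f x)|)
      atTop (𝓝 0) := by
  have hb1' (x : 𝔼) (hx : x ∈ Metric.ball (0 : 𝔼) 1) : b =ᶠ[𝓝 x] fun _ => 1 := by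
    filter_upwards [Metric.isOpen_ball.mem_nhds hx] with y hy using hb1 y hy
  have hdb (x : 𝔼) (hx : ‖x‖ < 1) : fderiv ℝ b x = 0 := by
    rw [(hb1' x (by simpa using hx)).fderiv_eq]
    simp
  obtain ⟨C, hC⟩ : ∃ C, ∀ y : 𝔼, ‖‖y‖ • fderiv ℝ b y‖ ≤ C :=
    ((hbc.fderiv ℝ).smul_left (f := fun y : 𝔼 => ‖y‖)).exists_bound_of_continuous
      (continuous_norm.smul (hb.continuous_fderiv one_ne_zero))
  have hS : MeasurableSet {x : 𝔼 | 1 ≤ ‖x‖} :=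
    (isClosed_le continuous_const continuous_norm).measurableSet
  have hderiv (m : ℕ) (x : 𝔼) : fderiv ℝ (fun y => b ((m + 1 : ℝ)⁻¹ • y)) x =
      (m + 1 : ℝ)⁻¹ • fderiv ℝ b ((m + 1 : ℝ)⁻¹ • x) := fderiv_comp_smul _
  have hnorm (m : ℕ) (x : 𝔼) : ‖(m + 1 : ℝ)⁻¹ • x‖ = ‖x‖ / (m + 1) := by
    rw [norm_smul, Real.norm_of_nonneg (by positivity), inv_mul_eq_div]
  have hvanish (m : ℕ) (x : 𝔼) (hx : ‖x‖ < m + 1) :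
      fderiv ℝ (fun y => b ((m + 1 : ℝ)⁻¹ • y)) x = 0 := by
    rw [hderiv, hdb, smul_zero]
    rw [hnorm, div_lt_one (by positivity)]
    exact hx
  have hlim := tendsto_integral_of_dominated_convergence (μ := (volume : Measure 𝔼))
    (F := fun (m : ℕ) x => |ρ x * fderiv ℝ (fun y => b ((m + 1 : ℝ)⁻¹ • y)) x (f x)|)
    (f := fun _ => 0)
    ({x : 𝔼 | 1 ≤ ‖x‖}.indicator fun x => C * ‖(ρ x / ‖x‖) • f x‖) ?_ ?_ ?_ ?_
  · simpa using hlim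
  · intro m
    refine (continuous_mul_fderiv_apply hf hρ (hb.comp (contDiff_const_smul _))
      ?_).abs.aestronglyMeasurable
    have h : Tendsto (fun y : 𝔼 => (m + 1 : ℝ)⁻¹ • y) (𝓝 0) (𝓝 0) := by
      simpa using (continuous_const_smul (m + 1 : ℝ)⁻¹).tendsto (0 : 𝔼)
    exact h.eventually (hb1' 0 (by simp))
  · exact (integrable_indicator_iff hS).2 (h_int.norm.const_mul C)
  · intro m
    refine .of_forall fun x => ?_
    rw [Real.norm_eq_abs, abs_abs]
    by_cases hx : 1 ≤ ‖x‖
    · rw [Set.indicator_of_mem (show x ∈ {x : 𝔼 | 1 ≤ ‖x‖} from hx)]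
      have hx0 : 0 < ‖x‖ := zero_lt_one.trans_le hx
      have hD : ‖x‖ * ‖fderiv ℝ (fun y => b ((m + 1 : ℝ)⁻¹ • y)) x‖ ≤ C := by
        refine le_trans (le_of_eq ?_) (hC ((m + 1 : ℝ)⁻¹ • x))
        rw [hderiv, norm_smul, norm_smul, norm_norm, hnorm, Real.norm_of_nonneg (by positivity)]
        ring
      rw [abs_mul, norm_smul, norm_div, norm_norm, Real.norm_eq_abs]
      calc |ρ x| * |fderiv ℝ (fun y => b ((m + 1 : ℝ)⁻¹ • y)) x (f x)|
          ≤ |ρ x| * (C / ‖x‖ * ‖f x‖) := by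
            gcongr
            refine ((fderiv ℝ (fun y => b ((m + 1 : ℝ)⁻¹ • y)) x).le_opNorm (f x)).trans ?_
            gcongr
            rwa [le_div_iff₀' hx0]
        _ = C * (|ρ x| / ‖x‖ * ‖f x‖) := by ring
    · rw [Set.indicator_of_notMem (by simpa using hx), hvanish m x]
      · simp
      · have : (0 : ℝ) ≤ m := m.cast_nonneg
        linarith
  · refine .of_forall fun x => tendsto_const_nhds.congr' ?_
    obtain ⟨N, hN⟩ := exists_nat_gt ‖x‖
    filter_upwards [eventually_ge_atTop N] with m hm
    rw [hvanish m x]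
    · simp
    · have : (N : ℝ) ≤ m := by exact_mod_cast hm
      linarith

/-- For almost every initial condition, the total occupation of `θ`, a function vanishing near the
origin, is finite. -/
lemma ae_not_tendsto_occupation_atTop (hf : ContDiff ℝ 1 f) (hf0 : f 0 = 0)
    (hs0 : ∀ x, s 0 x = x)
    (hs : ∀ x, ∀ t : ℝ, 0 ≤ t → HasDerivAt (fun τ => s τ x) (f (s t x)) t)
    (hρ0 : ∀ x, x ≠ 0 → 0 ≤ ρ x) (hρ : ContDiffOn ℝ 1 ρ {(0 : 𝔼)}ᶜ)
    (h_int : IntegrableOn (fun x => (ρ x / ‖x‖) • f x) {x : 𝔼 | 1 ≤ ‖x‖})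
    (hdiv : ∀ᵐ x : 𝔼, 0 < divergence (fun y => ρ y • f y) x)
    {θ : 𝔼 → ℝ} {C : ℝ≥0} (hθ : LipschitzWith C θ) (hθ0 : ∀ x, 0 ≤ θ x) (hθz : θ =ᶠ[𝓝 0] 0) :
    ∀ᵐ x : 𝔼, ¬ Tendsto (fun k : ℕ => ∫ t in (0 : ℝ)..k, θ (s t x)) atTop atTop := by
  let b : ContDiffBump (0 : 𝔼) := ⟨1, 2, one_pos, one_lt_two⟩
  have hb1 (x : 𝔼) (hx : x ∈ Metric.ball (0 : 𝔼) 1) : b x = 1 :=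
    b.one_of_mem_closedBall (Metric.ball_subset_closedBall hx)
  let χ : ℕ → 𝔼 → ℝ := fun m x => b ((m + 1 : ℝ)⁻¹ • x)
  have hχ (m : ℕ) : ContDiff ℝ 1 (χ m) := b.contDiff.comp (contDiff_const_smul _)
  have hχ1 (m : ℕ) {x : 𝔼} (hx : ‖x‖ < m + 1) : χ m x = 1 := by
    refine hb1 _ ?_
    rw [mem_ball_zero_iff, norm_smul, Real.norm_of_nonneg (by positivity), inv_mul_eq_div,
      div_lt_one (by positivity)]
    exact hx
  let A : ℕ → ℝ := fun m => ∫ x, χ m x * ρ x * θ x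
  let c : ℕ → ℝ := fun m => ((m + 1) * (|A m| + 1))⁻¹
  have hc (m : ℕ) : 0 < c m := by positivity
  have hcA (m : ℕ) : c m * A m ≤ 1 / (m + 1 : ℝ) := by
    rw [inv_mul_le_iff₀ (by positivity), mul_one_div, mul_div_cancel_left₀ _ (by positivity)]
    linarith [le_abs_self (A m)]
  let E : ℕ → ℝ := fun m => ∫ x, |ρ x * fderiv ℝ (χ m) x (f x)|
  have hE : Tendsto E atTop (𝓝 0) :=
    tendsto_integral_abs_mul_fderiv_cutoff hf.continuous hρ.continuousOn h_int b.contDiff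
      b.hasCompactSupport hb1
  let d : 𝔼 → ℝ := divergence fun y => ρ y • f y
  let V : ℕ → ℕ → 𝔼 → ℝ := fun m k => truncatedOccupation s (fun x => c m * θ x) k
  have hcθ (m : ℕ) : ∃ K, LipschitzWith K fun x => c m * θ x :=
    ⟨_, (lipschitzWith_smul (c m)).comp hθ⟩
  let F : ℕ → ℕ → 𝔼 → ℝ≥0∞ := fun m k x => ENNReal.ofReal (V m k x * (χ m x * d x))
  have hFm (m k : ℕ) : Measurable (F m k) := by
    obtain ⟨K, hK⟩ := hcθ m
    exact ((locallyLipschitz_truncatedOccupation hf.locallyLipschitz hs0 hs hK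
      k.cast_nonneg).continuous.measurable.mul
        ((hχ m).continuous.measurable.mul (measurable_divergence _))).ennreal_ofReal
  have hF (m k : ℕ) : ∫⁻ x, F m k x ≤ ENNReal.ofReal (1 / (m + 1 : ℝ) + E m) := by
    obtain ⟨K, hK⟩ := hcθ m
    refine (lintegral_truncatedOccupation_mul_divergence_le hf hf0 hs0 hs hρ0 hρ hdiv hK
      (fun x => mul_nonneg (hc m).le (hθ0 x)) ?_ (hχ m) ?_ (fun x => b.nonneg) ?_
      k.cast_nonneg).trans (ENNReal.ofReal_le_ofReal (add_le_add_left ?_ _))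
    · filter_upwards [hθz] with x hx
      simp [hx]
    · exact b.hasCompactSupport.comp_smul (by positivity)
    · filter_upwards [Metric.ball_mem_nhds (0 : 𝔼) one_pos] with x hx
      refine hχ1 m ?_
      rw [mem_ball_zero_iff] at hx
      have : (0 : ℝ) ≤ m := m.cast_nonneg
      linarith
    · refine le_trans (le_of_eq ?_) (hcA m)
      rw [← integral_const_mul]
      congr with x
      ring
  have hlim : Tendsto (fun m : ℕ => ENNReal.ofReal (1 / (m + 1 : ℝ) + E m)) atTop (𝓝 0) := by
    simpa using ENNReal.tendsto_ofReal (tendsto_one_div_add_atTop_nhds_zero_nat.add hE)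
  have hzero : ∫⁻ x, liminf (fun m => liminf (fun k => F m k x) atTop) atTop = 0 := by
    refine le_antisymm ?_ zero_le
    refine (lintegral_liminf_le fun m => Measurable.liminf (hFm m)).trans ?_
    rw [← hlim.liminf_eq]
    refine liminf_le_liminf (.of_forall fun m => (lintegral_liminf_le (hFm m)).trans ?_)
    exact (liminf_le_liminf (.of_forall (hF m))).trans (liminf_const _).le
  rw [lintegral_eq_zero_iff (Measurable.liminf fun m => Measurable.liminf (hFm m))] at hzero
  filter_upwards [hzero, hdiv] with x hx hd hT
  have hk (m : ℕ) : liminf (fun k => F m k x) atTop = ENNReal.ofReal (χ m x * d x) := by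
    refine Tendsto.liminf_eq (tendsto_const_nhds.congr' ?_)
    filter_upwards [hT.eventually_ge_atTop (c m)⁻¹] with k hk
    have hV : V m k x = 1 := by
      refine min_eq_left ?_
      rw [intervalIntegral.integral_const_mul]
      rwa [inv_le_iff_one_le_mul₀' (hc m)] at hk
    simp only [F, hV, one_mul]
  have hm : liminf (fun m => liminf (fun k => F m k x) atTop) atTop = ENNReal.ofReal (d x) := by
    refine Tendsto.liminf_eq (tendsto_const_nhds.congr' ?_)
    obtain ⟨N, hN⟩ := exists_nat_gt ‖x‖
    filter_upwards [eventually_ge_atTop N] with m hm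
    have : (N : ℝ) ≤ m := by exact_mod_cast hm
    rw [hk, hχ1 m (by linarith), one_mul]
  rw [hm] at hx
  exact (ENNReal.ofReal_pos.2 hd).ne' hx

/-- Barbalat's lemma along a trajectory. -/
lemma tendsto_comp_flow_zero
    (hs : ∀ x, ∀ t : ℝ, 0 ≤ t → HasDerivAt (fun τ => s τ x) (f (s t x)) t) (hf : Continuous f)
    {θ : 𝔼 → ℝ} (hθ : ContDiff ℝ 1 θ) (hθ0 : ∀ x, 0 ≤ θ x) (hθ1 : ∀ x, θ x ≤ 1)
    {L : ℝ} (hL : ∀ x, ‖fderiv ℝ θ x (f x)‖ ≤ L) {x : 𝔼}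
    (hx : ¬ Tendsto (fun k : ℕ => ∫ t in (0 : ℝ)..k, θ (s t x)) atTop atTop) :
    Tendsto (fun t => θ (s t x)) atTop (𝓝 0) := by
  have hii := fun {a b : ℝ} (ha : 0 ≤ a) (hb : 0 ≤ b) =>
    intervalIntegrable_comp_flow hs hθ.continuous x ha hb
  have hmono : Monotone fun k : ℕ => ∫ t in (0 : ℝ)..k, θ (s t x) := fun k l hkl =>
    intervalIntegral.integral_mono_interval le_rfl k.cast_nonneg (by exact_mod_cast hkl)
      (.of_forall fun t => hθ0 _) (hii le_rfl l.cast_nonneg)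
  obtain ⟨I, hI⟩ := (tendsto_atTop_of_monotone hmono).resolve_left hx
  have hint : IntegrableOn (fun t => θ (s t x)) (Set.Ioi 0) := by
    refine integrableOn_Ioi_of_intervalIntegral_norm_tendsto I 0
      (fun k : ℕ => (hii le_rfl k.cast_nonneg).1) tendsto_natCast_atTop_atTop ?_
    simpa only [Real.norm_of_nonneg (hθ0 _)] using hI
  have hderiv (t : ℝ) (ht : t ∈ Set.Ioi (0 : ℝ)) : HasDerivAt (fun t => θ (s t x) ^ 2)
      (2 * θ (s t x) * fderiv ℝ θ (s t x) (f (s t x))) t := by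
    have h := ((hθ.differentiable one_ne_zero (s t x)).hasFDerivAt.comp_hasDerivAt t
      (hs x t (le_of_lt ht))).pow 2
    exact h.congr_deriv (by simp)
  have hcont {g : 𝔼 → ℝ} (hg : Continuous g) :
      AEStronglyMeasurable (fun t => g (s t x)) (volume.restrict (Set.Ioi 0)) :=
    ((continuousOn_comp_flow hs hg x).mono Set.Ioi_subset_Ici_self).aestronglyMeasurable
      measurableSet_Ioi
  have hsq : Tendsto (fun t => θ (s t x) ^ 2) atTop (𝓝 0) := by
    refine tendsto_zero_of_hasDerivAt_of_integrableOn_Ioi hderiv ?_ ?_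
    · refine (hint.const_mul (2 * L)).mono' (hcont (g := fun y => 2 * θ y * fderiv ℝ θ y (f y))
        ((continuous_const.mul hθ.continuous).mul
          ((hθ.continuous_fderiv one_ne_zero).clm_apply hf))) (.of_forall fun t => ?_)
      rw [norm_mul, norm_mul, Real.norm_two, Real.norm_of_nonneg (hθ0 _)]
      nlinarith [mul_le_mul_of_nonneg_left (hL (s t x)) (hθ0 (s t x))]
    · refine hint.mono' (hcont (hθ.continuous.pow 2)) (.of_forall fun t => ?_)
      rw [norm_pow, Real.norm_of_nonneg (hθ0 _)]
      nlinarith [hθ0 (s t x), hθ1 (s t x)]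
  simpa [Real.sqrt_sq (hθ0 _)] using hsq.sqrt

lemma ae_eventually_norm_flow_lt (hf : ContDiff ℝ 1 f) (hf0 : f 0 = 0)
    (hs0 : ∀ x, s 0 x = x)
    (hs : ∀ x, ∀ t : ℝ, 0 ≤ t → HasDerivAt (fun τ => s τ x) (f (s t x)) t)
    (hρ0 : ∀ x, x ≠ 0 → 0 ≤ ρ x) (hρ : ContDiffOn ℝ 1 ρ {(0 : 𝔼)}ᶜ)
    (h_int : IntegrableOn (fun x => (ρ x / ‖x‖) • f x) {x : 𝔼 | 1 ≤ ‖x‖})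
    (hdiv : ∀ᵐ x : 𝔼, 0 < divergence (fun y => ρ y • f y) x) {r : ℝ} (hr : 0 < r) :
    ∀ᵐ x : 𝔼, ∀ᶠ t in atTop, ‖s t x‖ < r := by
  let β : ContDiffBump (0 : 𝔼) := ⟨r / 2, r, half_pos hr, half_lt_self hr⟩
  let θ : 𝔼 → ℝ := fun x => 1 - β x
  have hθ : ContDiff ℝ 1 θ := contDiff_const.sub β.contDiff
  obtain ⟨K, hK⟩ := ContDiff.lipschitzWith_of_hasCompactSupport (𝕂 := ℝ) (n := 1)
    β.hasCompactSupport β.contDiff one_ne_zero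
  have hθL : LipschitzWith (0 + K) θ := (LipschitzWith.const (1 : ℝ)).sub hK
  have hθ0 (x : 𝔼) : 0 ≤ θ x := sub_nonneg.2 β.le_one
  have hθ1 (x : 𝔼) : θ x ≤ 1 := sub_le_self _ β.nonneg
  have hθz : θ =ᶠ[𝓝 0] 0 := by
    filter_upwards [β.eventuallyEq_one] with x hx
    simp [θ, hx]
  have hdθ (x : 𝔼) : fderiv ℝ θ x = -fderiv ℝ β x := fderiv_const_sub _
  have hsupp : HasCompactSupport fun x => fderiv ℝ θ x (f x) := by
    refine (β.hasCompactSupport.fderiv ℝ).mono fun x hx => ?_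
    contrapose! hx
    simp [hdθ, Function.notMem_support.1 hx]
  obtain ⟨L, hL⟩ := hsupp.exists_bound_of_continuous
    ((hθ.continuous_fderiv one_ne_zero).clm_apply hf.continuous)
  filter_upwards [ae_not_tendsto_occupation_atTop hf hf0 hs0 hs hρ0 hρ h_int hdiv hθL hθ0 hθz]
    with x hx
  filter_upwards [(tendsto_comp_flow_zero hs hf.continuous hθ hθ0 hθ1 hL hx).eventually_lt_const
    one_pos] with t ht
  by_contra! h
  have h0 : β (s t x) = 0 := β.zero_of_le_dist (by simpa using h)
  simp [θ, h0] at ht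

end Divergence

/-- Rantzer's dual Lyapunov theorem (convergence part): if the divergence of `ρ • f`
is almost everywhere positive and `ρ f / ‖x‖` is integrable away from the unit ball,
then almost every trajectory of `ẋ = f(x)` converges to the origin. -/
theorem rantzer_dual_lyapunov_convergence {n : ℕ}
    (f : EuclideanSpace ℝ (Fin n) → EuclideanSpace ℝ (Fin n))
    (hf : ContDiff ℝ 1 f) (hf0 : f 0 = 0)
    (s : ℝ → EuclideanSpace ℝ (Fin n) → EuclideanSpace ℝ (Fin n))
    (hs0 : ∀ x, s 0 x = x)
    (hs : ∀ x, ∀ t : ℝ, 0 ≤ t → HasDerivAt (fun τ => s τ x) (f (s t x)) t)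
    (ρ : EuclideanSpace ℝ (Fin n) → ℝ)
    (hρ_nonneg : ∀ x, x ≠ 0 → 0 ≤ ρ x)
    (hρ_C1 : ContDiffOn ℝ 1 ρ {(0 : EuclideanSpace ℝ (Fin n))}ᶜ)
    (h_int : IntegrableOn (fun x => (ρ x / ‖x‖) • f x)
      {x : EuclideanSpace ℝ (Fin n) | 1 ≤ ‖x‖} volume)
    (h_div : ∀ᵐ x : EuclideanSpace ℝ (Fin n) ∂volume,
      0 < divergence (fun y => ρ y • f y) x) :
    ∀ᵐ x : EuclideanSpace ℝ (Fin n) ∂volume,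
      Tendsto (fun t => s t x) atTop (𝓝 (0 : EuclideanSpace ℝ (Fin n))) := by
  have h : ∀ᵐ x : EuclideanSpace ℝ (Fin n), ∀ m : ℕ, ∀ᶠ t in atTop, ‖s t x‖ < 1 / (m + 1 : ℝ) :=
    ae_all_iff.2 fun m => ae_eventually_norm_flow_lt hf hf0 hs0 hs hρ_nonneg hρ_C1 h_int h_div
      Nat.one_div_pos_of_nat
  filter_upwards [h] with x hx
  rw [Metric.tendsto_nhds]
  intro ε hε
  obtain ⟨m, hm⟩ := exists_nat_one_div_lt hε
  filter_upwards [hx m] with t ht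
  rw [dist_zero_right]
  exact ht.trans hm
end

section
/- Let f : ℝⁿ → ℝⁿ be a continuously differentiable vector field with f(0) = 0, and suppose there is a global forward flow s : ℝ → ℝⁿ → ℝⁿ such that for every x ∈ ℝⁿ, t ↦ s t x is differentiable on [0, ∞) with derivative f(s t x) and s 0 x = x. Suppose there exists a nonnegative function ρ : ℝⁿ \ {0} → ℝ, continuously differentiable on ℝⁿ \ {0}, such that x ↦ ρ(x) f(x) / ‖x‖ is integrable on {x : ‖x‖ ≥ 1}, and ∇·(ρ f)(x) > 0 for Lebesgue-almost every x ∈ ℝⁿ. Let X_u ⊆ ℝⁿ be a measurable set with 0 ∉ X_u on which ρ vanishes identically. Then for Lebesgue-almost every initial condition x ∈ ℝⁿ, the occupancy of the trajectory in X_u is zero, i.e. the one-dimensional Lebesgue measure of the set {t ≥ 0 : s t x ∈ X_u} equals zero. -/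
open MeasureTheory Filter Topology

section AutonomousODE

variable {E : Type*} [NormedAddCommGroup E] [NormedSpace ℝ E]

/-- A trajectory defined for all nonnegative times is bounded on every compact time interval. -/
theorem exists_norm_le_of_hasDerivAt {u u' : ℝ → E}
    (hu : ∀ t : ℝ, 0 ≤ t → HasDerivAt u (u' t) t) (T : ℝ) :
    ∃ R : ℝ, ∀ τ ∈ Set.Icc 0 T, ‖u τ‖ ≤ R :=
  isCompact_Icc.exists_bound_of_continuousOn
    fun τ hτ => (hu τ hτ.1).continuousAt.continuousWithinAt

variable {f : E → E} {s : ℝ → E → E}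

/-- Backward Grönwall estimate: trajectories staying in a region where the vector field is
Lipschitz cannot approach each other faster than exponentially. -/
theorem dist_initial_le_of_forward_flow (hs0 : ∀ x, s 0 x = x)
    (hs : ∀ x, ∀ t : ℝ, 0 ≤ t → HasDerivAt (fun τ => s τ x) (f (s t x)) t)
    {S : Set E} {K : NNReal} (hK : LipschitzOnWith K f S) {T : ℝ} (hT : 0 ≤ T) {x y : E}
    (hx : ∀ τ ∈ Set.Icc 0 T, s τ x ∈ S) (hy : ∀ τ ∈ Set.Icc 0 T, s τ y ∈ S) :
    dist x y ≤ dist (s T x) (s T y) * Real.exp (K * T) := by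
  have hderiv : ∀ z, ∀ τ ≤ T,
      HasDerivAt (fun τ => s (T - τ) z) (-f (s (T - τ) z)) τ := fun z τ hτ => by
    simpa [Function.comp_def] using
      (hs z (T - τ) (by linarith)).scomp τ ((hasDerivAt_id τ).const_sub T)
  have hmem : ∀ τ ∈ Set.Ico 0 T, T - τ ∈ Set.Icc 0 T := fun τ hτ =>
    ⟨by linarith [hτ.2], by linarith [hτ.1]⟩
  have := dist_le_of_trajectories_ODE_of_mem (v := fun _ z => -f z) (s := fun _ => S) (K := K)
    (f := fun τ => s (T - τ) x) (g := fun τ => s (T - τ) y) (a := 0) (b := T)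
    (δ := dist (s T x) (s T y))
    (fun _ _ => hK.neg)
    (fun τ hτ => (hderiv x τ hτ.2).continuousAt.continuousWithinAt)
    (fun τ hτ => (hderiv x τ hτ.2.le).hasDerivWithinAt)
    (fun τ hτ => hx _ (hmem τ hτ))
    (fun τ hτ => (hderiv y τ hτ.2).continuousAt.continuousWithinAt)
    (fun τ hτ => (hderiv y τ hτ.2.le).hasDerivWithinAt)
    (fun τ hτ => hy _ (hmem τ hτ)) (by simp) T ⟨hT, le_rfl⟩
  simpa [hs0] using this

variable [FiniteDimensional ℝ E]

/-- A `C¹` map on a finite-dimensional space is Lipschitz on every closed ball around `0`. -/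
theorem ContDiff.exists_lipschitzOnWith_closedBall {f : E → E} (hf : ContDiff ℝ 1 f) (R : ℝ) :
    ∃ K, LipschitzOnWith K f (Metric.closedBall 0 R) :=
  have : ProperSpace E := FiniteDimensional.proper ℝ E
  hf.locallyLipschitz.locallyLipschitzOn.exists_lipschitzOnWith_of_compact
    (isCompact_closedBall 0 R)

/-- The time-`T` map of a global forward flow of a `C¹` vector field is continuous. -/
theorem continuous_forward_flow (hf : ContDiff ℝ 1 f) (hs0 : ∀ x, s 0 x = x)
    (hs : ∀ x, ∀ t : ℝ, 0 ≤ t → HasDerivAt (fun τ => s τ x) (f (s t x)) t)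
    {T : ℝ} (hT : 0 ≤ T) : Continuous (s T) := by
  rw [continuous_iff_continuousAt]
  intro x₀
  obtain ⟨R, hR⟩ := exists_norm_le_of_hasDerivAt (hs x₀) T
  obtain ⟨K, hK⟩ := hf.exists_lipschitzOnWith_closedBall (R + 1)
  set L : ℝ := K + 1
  have hL : 0 < L := by positivity
  have key : ∀ δ : ℝ, 0 < δ → δ * Real.exp (L * T) ≤ 1 → ∀ x, ‖x - x₀‖ ≤ δ →
      ‖s T x - s T x₀‖ ≤ δ * Real.exp (L * T) := by
    intro δ hδ hδ1 x hx
    refine image_norm_le_of_norm_deriv_right_lt_deriv_boundary (a := 0) (b := T)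
      (f := fun τ => s τ x - s τ x₀) (f' := fun τ => f (s τ x) - f (s τ x₀))
      (B := fun τ => δ * Real.exp (L * τ)) (B' := fun τ => L * (δ * Real.exp (L * τ)))
      ?_ ?_ ?_ ?_ ?_ ⟨hT, le_rfl⟩
    · intro τ hτ
      exact ((hs x τ hτ.1).sub (hs x₀ τ hτ.1)).continuousAt.continuousWithinAt
    · intro τ hτ
      exact ((hs x τ hτ.1).sub (hs x₀ τ hτ.1)).hasDerivWithinAt
    · simpa [hs0] using hx
    · intro τ
      exact (((hasDerivAt_id' τ).const_mul L).exp.const_mul δ).congr_deriv (by ring)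
    · intro τ hτ heq
      have hB : 0 < δ * Real.exp (L * τ) := by positivity
      have hle : ‖s τ x - s τ x₀‖ ≤ 1 := by
        rw [heq]
        refine le_trans ?_ hδ1
        gcongr
        exact hτ.2.le
      have h₀ : ‖s τ x₀‖ ≤ R := hR τ ⟨hτ.1, hτ.2.le⟩
      have h₁ : ‖s τ x‖ ≤ R + 1 := by
        have := norm_add_le (s τ x - s τ x₀) (s τ x₀)
        rw [sub_add_cancel] at this
        linarith
      have hlip := hK.norm_sub_le (x := s τ x) (y := s τ x₀)
        (by simpa using h₁) (by simpa using h₀.trans (by linarith))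
      calc ‖f (s τ x) - f (s τ x₀)‖ ≤ K * (δ * Real.exp (L * τ)) := by rwa [heq] at hlip
        _ < L * (δ * Real.exp (L * τ)) := by gcongr; simp [L]
  rw [Metric.continuousAt_iff]
  intro ε hε
  refine ⟨min 1 (ε / 2) * Real.exp (-(L * T)), by positivity, fun {x} hx => ?_⟩
  have hexp : min 1 (ε / 2) * Real.exp (-(L * T)) * Real.exp (L * T) = min 1 (ε / 2) := by
    rw [mul_assoc, ← Real.exp_add]
    simp
  have := key _ (by positivity) (hexp ▸ min_le_left _ _) x (by rw [← dist_eq_norm]; exact hx.le)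
  rw [hexp] at this
  rw [dist_eq_norm]
  linarith [min_le_right 1 (ε / 2)]

variable [MeasurableSpace E] [BorelSpace E]

/-- If `g` expands distances on `A` up to a constant factor, then the points of `A` mapped by `g`
to a null set form a null set. -/
theorem addHaar_inter_preimage_eq_zero_of_dist_le (μ : Measure E) [μ.IsAddHaarMeasure]
    {g : E → E} {A N : Set E} {C : NNReal}
    (hg : ∀ x ∈ A, ∀ y ∈ A, dist x y ≤ C * dist (g x) (g y)) (hN : μ N = 0) :
    μ (A ∩ g ⁻¹' N) = 0 := by
  have hinj : Set.InjOn g A := fun x hx y hy hxy => by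
    simpa [hxy] using hg x hx y hy
  have hleft : Set.LeftInvOn (Function.invFunOn g A) g A := hinj.leftInvOn_invFunOn
  have hlip : LipschitzOnWith C (Function.invFunOn g A) (g '' (A ∩ g ⁻¹' N)) := by
    refine LipschitzOnWith.of_dist_le_mul ?_
    rintro _ ⟨x, hx, rfl⟩ _ ⟨y, hy, rfl⟩
    rw [hleft hx.1, hleft hy.1]
    exact hg x hx.1 y hy.1
  have himage : Function.invFunOn g A '' (g '' (A ∩ g ⁻¹' N)) = A ∩ g ⁻¹' N :=
    (hleft.mono Set.inter_subset_left).image_image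
  refine Measure.absolutelyContinuous_isAddHaarMeasure μ
    (Measure.hausdorffMeasure (Module.finrank ℝ E : ℝ)) ?_
  have hN' : Measure.hausdorffMeasure (Module.finrank ℝ E : ℝ) (g '' (A ∩ g ⁻¹' N)) = 0 :=
    measure_mono_null (by rintro _ ⟨x, hx, rfl⟩; exact hx.2)
      (Measure.absolutelyContinuous_isAddHaarMeasure
        (Measure.hausdorffMeasure (Module.finrank ℝ E : ℝ)) μ hN)
  rw [← himage]
  have := hlip.hausdorffMeasure_image_le (d := Module.finrank ℝ E) (by positivity)
  rwa [hN', mul_zero, nonpos_iff_eq_zero] at this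

/-- The time-`T` map of a global forward flow of a `C¹` vector field pulls null sets back to
null sets. -/
theorem addHaar_preimage_forward_flow_eq_zero (μ : Measure E) [μ.IsAddHaarMeasure]
    (hf : ContDiff ℝ 1 f) (hs0 : ∀ x, s 0 x = x)
    (hs : ∀ x, ∀ t : ℝ, 0 ≤ t → HasDerivAt (fun τ => s τ x) (f (s t x)) t)
    {T : ℝ} (hT : 0 ≤ T) {N : Set E} (hN : μ N = 0) : μ (s T ⁻¹' N) = 0 := by
  let A : ℕ → Set E := fun k => {x | ∀ τ ∈ Set.Icc 0 T, s τ x ∈ Metric.closedBall 0 (k : ℝ)}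
  have hcover : s T ⁻¹' N ⊆ ⋃ k, A k ∩ s T ⁻¹' N := by
    intro x hx
    obtain ⟨R, hR⟩ := exists_norm_le_of_hasDerivAt (hs x) T
    obtain ⟨k, hk⟩ := exists_nat_ge R
    exact Set.mem_iUnion.2 ⟨k, fun τ hτ => by simpa using (hR τ hτ).trans hk, hx⟩
  refine measure_mono_null hcover (measure_iUnion_null fun k => ?_)
  obtain ⟨K, hK⟩ := hf.exists_lipschitzOnWith_closedBall (k : ℝ)
  refine addHaar_inter_preimage_eq_zero_of_dist_le μ (C := NNReal.mk (Real.exp (K * T)) (by positivity))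
    (fun x hx y hy => ?_) hN
  rw [NNReal.coe_mk, mul_comm]
  exact dist_initial_le_of_forward_flow hs0 hs hK hT hx hy

/-- Almost every trajectory of a global forward flow of a `C¹` vector field spends zero time in a
given null set. -/
theorem ae_occupancy_eq_zero (μ : Measure E) [μ.IsAddHaarMeasure]
    (hf : ContDiff ℝ 1 f) (hs0 : ∀ x, s 0 x = x)
    (hs : ∀ x, ∀ t : ℝ, 0 ≤ t → HasDerivAt (fun τ => s τ x) (f (s t x)) t)
    {N : Set E} (hN_meas : MeasurableSet N) (hN : μ N = 0) :
    ∀ᵐ x ∂μ, volume {t : ℝ | 0 ≤ t ∧ s t x ∈ N} = 0 := by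
  have hmeas : Measurable (Function.uncurry fun (t : ℝ) x => s (max t 0) x) :=
    measurable_uncurry_of_continuous_of_measurable
      (fun x => continuous_iff_continuousAt.2 fun t =>
        ContinuousAt.comp (f := fun t : ℝ => max t 0) (g := fun t => s t x)
          (hs x _ (le_max_right t 0)).continuousAt (by fun_prop))
      (fun t => (continuous_forward_flow hf hs0 hs (le_max_right t 0)).measurable)
  have hset : MeasurableSet {p : E × ℝ | ¬(0 ≤ p.2 ∧ s (max p.2 0) p.1 ∈ N)} :=
    ((measurableSet_le measurable_const measurable_snd).inter
      ((hmeas.comp measurable_swap) hN_meas)).compl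
  have hcomm := (Measure.ae_ae_comm (μ := μ) (ν := (volume : Measure ℝ))
    (p := fun x t => ¬(0 ≤ t ∧ s (max t 0) x ∈ N)) hset).2 <| ae_of_all _ fun t => by
      refine measure_mono_null (fun x hx => ?_)
        (addHaar_preimage_forward_flow_eq_zero μ hf hs0 hs (le_max_right t 0) hN)
      exact (not_not.1 hx).2
  filter_upwards [hcomm] with x hx
  refine measure_mono_null (fun t ht => ?_) (ae_iff.1 hx)
  simpa [max_eq_left ht.1] using ht

end AutonomousODE

/-- If `ρ ≥ 0` near a zero `y` of `ρ`, then the divergence of `ρ f` vanishes at `y`. -/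
theorem divergence_smul_eq_zero_of_isLocalMin {n : ℕ}
    {f : EuclideanSpace ℝ (Fin n) → EuclideanSpace ℝ (Fin n)}
    {ρ : EuclideanSpace ℝ (Fin n) → ℝ} {y : EuclideanSpace ℝ (Fin n)}
    (hf : DifferentiableAt ℝ f y) (hρ : DifferentiableAt ℝ ρ y)
    (hmin : IsLocalMin ρ y) (hy : ρ y = 0) :
    divergence (fun z => ρ z • f z) y = 0 := by
  simp [divergence, fderiv_fun_smul hρ hf, hmin.fderiv_eq_zero, hy]

/-- Rantzer's dual Lyapunov theorem (avoidance part): under the hypotheses of the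
dual Lyapunov theorem, if moreover `ρ` vanishes identically on a measurable set `Xu`
not containing the origin, then for almost every initial condition the occupancy of
the trajectory in `Xu` (the Lebesgue measure of the time set spent in `Xu`) is zero. -/
theorem rantzer_dual_lyapunov_avoidance {n : ℕ}
    (f : EuclideanSpace ℝ (Fin n) → EuclideanSpace ℝ (Fin n))
    (hf : ContDiff ℝ 1 f) (hf0 : f 0 = 0)
    (s : ℝ → EuclideanSpace ℝ (Fin n) → EuclideanSpace ℝ (Fin n))
    (hs0 : ∀ x, s 0 x = x)
    (hs : ∀ x, ∀ t : ℝ, 0 ≤ t → HasDerivAt (fun τ => s τ x) (f (s t x)) t)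
    (ρ : EuclideanSpace ℝ (Fin n) → ℝ)
    (hρ_nonneg : ∀ x, x ≠ 0 → 0 ≤ ρ x)
    (hρ_C1 : ContDiffOn ℝ 1 ρ {(0 : EuclideanSpace ℝ (Fin n))}ᶜ)
    (h_int : IntegrableOn (fun x => (ρ x / ‖x‖) • f x)
      {x : EuclideanSpace ℝ (Fin n) | 1 ≤ ‖x‖} volume)
    (h_div : ∀ᵐ x : EuclideanSpace ℝ (Fin n) ∂volume,
      0 < divergence (fun y => ρ y • f y) x)
    (Xu : Set (EuclideanSpace ℝ (Fin n)))
    (hXu_meas : MeasurableSet Xu)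
    (hXu_0 : (0 : EuclideanSpace ℝ (Fin n)) ∉ Xu)
    (hρ_Xu : ∀ y ∈ Xu, ρ y = 0) :
    ∀ᵐ x : EuclideanSpace ℝ (Fin n) ∂volume,
      volume {t : ℝ | 0 ≤ t ∧ s t x ∈ Xu} = 0 := by
  refine ae_occupancy_eq_zero volume hf hs0 hs hXu_meas
    (measure_mono_null (fun y hy => ?_) (ae_iff.1 h_div))
  have hy0 : y ≠ 0 := fun h => hXu_0 (h ▸ hy)
  have hnhds : {(0 : EuclideanSpace ℝ (Fin n))}ᶜ ∈ 𝓝 y := isOpen_compl_singleton.mem_nhds hy0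
  have hmin : IsLocalMin ρ y := by
    filter_upwards [hnhds] with z hz
    rw [hρ_Xu y hy]
    exact hρ_nonneg z hz
  have hdiv := divergence_smul_eq_zero_of_isLocalMin (hf.differentiable one_ne_zero y)
    ((hρ_C1.contDiffAt hnhds).differentiableAt one_ne_zero) hmin (hρ_Xu y hy)
  exact not_lt.2 hdiv.le
end

section
/- Let ρ : ℝⁿ → ℝ be a nonnegative continuously differentiable function and let X_u ⊆ ℝⁿ be a set on which ρ vanishes (ρ(y) = 0 for all y ∈ X_u). Let x : [0, ∞) → ℝⁿ be a solution of ẋ = ∇ρ(x), i.e. x is differentiable with x'(t) = ∇ρ(x(t)) for all t ≥ 0, and suppose ρ(x(0)) > 0. Then ρ(x(t)) ≥ ρ(x(0)) > 0 for all t ≥ 0, and consequently the trajectory never enters the unsafe set: x(t) ∉ X_u for all t ≥ 0. In particular, the occupancy of the trajectory in X_u, the Lebesgue measure of {t ≥ 0 : x(t) ∈ X_u}, is zero. -/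
open MeasureTheory

/-- Along a solution of `ẋ = ∇ρ(x)`, the derivative of `ρ` is `‖∇ρ(x)‖²`. -/
theorem hasDerivAt_comp_gradient_flow {E : Type*} [NormedAddCommGroup E]
    [InnerProductSpace ℝ E] [CompleteSpace E] {ρ : E → ℝ} {x : ℝ → E} {t : ℝ}
    (hρ : DifferentiableAt ℝ ρ (x t)) (hx : HasDerivAt x (gradient ρ (x t)) t) :
    HasDerivAt (fun s => ρ (x s)) (‖gradient ρ (x t)‖ ^ 2) t := by
  have h := hρ.hasGradientAt.hasFDerivAt.comp_hasDerivAt t hx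
  rwa [InnerProductSpace.toDual_apply_apply, real_inner_self_eq_norm_sq] at h

/-- A differentiable function is nondecreasing along its forward gradient flow. -/
theorem monotoneOn_comp_gradient_flow {E : Type*} [NormedAddCommGroup E]
    [InnerProductSpace ℝ E] [CompleteSpace E] {ρ : E → ℝ} {x : ℝ → E}
    (hρ : Differentiable ℝ ρ)
    (hx : ∀ t : ℝ, 0 ≤ t → HasDerivAt x (gradient ρ (x t)) t) :
    MonotoneOn (fun t => ρ (x t)) (Set.Ici 0) := by
  have hderiv : ∀ t : ℝ, 0 ≤ t →
      HasDerivAt (fun s => ρ (x s)) (‖gradient ρ (x t)‖ ^ 2) t :=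
    fun t ht => hasDerivAt_comp_gradient_flow (hρ _) (hx t ht)
  refine monotoneOn_of_hasDerivWithinAt_nonneg (convex_Ici 0)
    (fun t ht => (hderiv t ht).continuousAt.continuousWithinAt)
    (fun t ht => (hderiv t (interior_subset ht)).hasDerivWithinAt)
    (fun t _ => sq_nonneg _)

/-- If the nonnegative `C¹` density `ρ` vanishes on the unsafe set `Xu`, then any
solution of `ẋ = ∇ρ(x)` on `[0, ∞)` starting at a point of positive density keeps
density at least `ρ(x(0)) > 0`, never enters `Xu`, and hence has zero occupancy in
`Xu` (the Lebesgue measure of the set of times spent in `Xu` is zero). -/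
theorem gradient_flow_zero_occupancy {n : ℕ}
    (ρ : EuclideanSpace ℝ (Fin n) → ℝ)
    (hρ_nonneg : ∀ y, 0 ≤ ρ y) (hρ : ContDiff ℝ 1 ρ)
    (Xu : Set (EuclideanSpace ℝ (Fin n)))
    (hXu : ∀ y ∈ Xu, ρ y = 0)
    (x : ℝ → EuclideanSpace ℝ (Fin n))
    (hx : ∀ t : ℝ, 0 ≤ t → HasDerivAt x (gradient ρ (x t)) t)
    (h0 : 0 < ρ (x 0)) :
    (∀ t : ℝ, 0 ≤ t → ρ (x 0) ≤ ρ (x t)) ∧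
    (∀ t : ℝ, 0 ≤ t → x t ∉ Xu) ∧
    volume {t : ℝ | 0 ≤ t ∧ x t ∈ Xu} = 0 := by
  have hmono : ∀ t : ℝ, 0 ≤ t → ρ (x 0) ≤ ρ (x t) := fun t ht =>
    monotoneOn_comp_gradient_flow (hρ.differentiable one_ne_zero) hx
      Set.self_mem_Ici ht ht
  have havoid : ∀ t : ℝ, 0 ≤ t → x t ∉ Xu := fun t ht hmem =>
    (h0.trans_le (hmono t ht)).ne' (hXu _ hmem)
  refine ⟨hmono, havoid, ?_⟩
  have hempty : {t : ℝ | 0 ≤ t ∧ x t ∈ Xu} = ∅ :=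
    Set.eq_empty_of_forall_notMem fun t ht => havoid t ht.1 ht.2
  rw [hempty, measure_empty]
end
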